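/- In the EPG construction setup: for all distinct u, v ∈ V(T), the intersection 𝒞_u ∩ 𝒞_v contains a horizontal or vertical line segment of nonzero length (i.e., there exist distinct points p, q with the closed segment [p,q] ⊆ 𝒞_u ∩ 𝒞_v) if and only if uv is an edge of T or {u, v} = {a_i, a_{(i+1) mod k}} for some 0 ≤ i ≤ k−1. That is, the C-shapes {𝒞_u} form a valid B_2-EPG representation of the graph obtained from T by adding the cycle through its leaves in the order a_0, a_1, …, a_{k−1}. -/

import Mathlib

open SimpleGraph Set Function

/-- `u` is an ancestor of `v` with respect to root `r`:
`u` lies on the unique path in `T` from `r` to `v`. -/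
def IsAncestor {V : Type*} (T : SimpleGraph V) (r u v : V) : Prop :=
  ∀ p : T.Walk r v, p.IsPath → u ∈ p.support

/-- `u` is the parent of `v` with respect to root `r`. -/
def IsParent {V : Type*} (T : SimpleGraph V) (r u v : V) : Prop :=
  IsAncestor T r u v ∧ u ≠ v ∧ T.Adj u v

/-- `L^r(u)`: the set of leaves of `T` that are descendants of `u`. -/
def LeafSet {V : Type*} (T : SimpleGraph V) [Fintype V] [DecidableRel T.Adj] (r u : V) :
    Set V :=
  {c | T.degree c = 1 ∧ IsAncestor T r u c}

/-- The leaf `c_{j mod k}` index. -/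
def cidx {k : ℕ} (hk : 0 < k) (j : ℕ) : Fin k := ⟨j % k, Nat.mod_lt _ hk⟩

/-- A set `A` of leaves is cyclically consecutive with respect to the enumeration `c`. -/
def CycConsec {V : Type*} {k : ℕ} (hk : 0 < k) (c : Fin k → V) (A : Set V) : Prop :=
  ∃ j m : ℕ, A = {x | ∃ t ≤ m, x = c (cidx hk (j + t))}

/-- The C-shape `𝒞(x₁, x₂, x₃, y₁, y₂) ⊆ ℝ²`. -/
def CShape (x1 x2 x3 y1 y2 : ℝ) : Set (ℝ × ℝ) :=
  {p | p.1 = x1 ∧ y1 ≤ p.2 ∧ p.2 ≤ y2} ∪ {p | p.2 = y1 ∧ x1 ≤ p.1 ∧ p.1 ≤ x2} ∪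
    {p | p.2 = y2 ∧ x1 ≤ p.1 ∧ p.1 ≤ x3}

/-- Two subsets of `ℝ²` share a segment of nonzero length. -/
def SharesSeg (A B : Set (ℝ × ℝ)) : Prop :=
  ∃ p q : ℝ × ℝ, p ≠ q ∧ segment ℝ p q ⊆ A ∩ B


/-! ### Overlapping C-shapes -/

lemma segment_infinite {p q : ℝ × ℝ} (hpq : p ≠ q) : (segment ℝ p q).Infinite := by
  rw [segment_eq_image_lineMap]
  exact (Set.Icc_infinite zero_lt_one).image (AffineMap.lineMap_injective ℝ hpq).injOn

lemma sharesSeg_comm (A B : Set (ℝ × ℝ)) : SharesSeg A B ↔ SharesSeg B A := by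
  simp only [SharesSeg, Set.inter_comm A B]

lemma SharesSeg.mono {A B C D : Set (ℝ × ℝ)} (hAC : A ⊆ C) (hBD : B ⊆ D)
    (hs : SharesSeg A B) : SharesSeg C D := by
  obtain ⟨p, q, hpq, hsub⟩ := hs
  exact ⟨p, q, hpq, hsub.trans (Set.inter_subset_inter hAC hBD)⟩

/-- The closed horizontal segment at height `y` between abscissae `x₁` and `x₂`. -/
def hSeg (y x₁ x₂ : ℝ) : Set (ℝ × ℝ) := {p | p.2 = y ∧ x₁ ≤ p.1 ∧ p.1 ≤ x₂}

/-- The closed vertical segment at abscissa `x` between heights `y₁` and `y₂`. -/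
def vSeg (x y₁ y₂ : ℝ) : Set (ℝ × ℝ) := {p | p.1 = x ∧ y₁ ≤ p.2 ∧ p.2 ≤ y₂}

lemma hSeg_eq_Icc (y x₁ x₂ : ℝ) : hSeg y x₁ x₂ = Set.Icc (x₁, y) (x₂, y) := by
  ext ⟨p, q⟩
  simp only [hSeg, Set.mem_ofPred_eq, Set.mem_Icc, Prod.mk_le_mk]
  constructor
  · rintro ⟨rfl, h₁, h₂⟩
    exact ⟨⟨h₁, le_rfl⟩, h₂, le_rfl⟩
  · rintro ⟨⟨h₁, h₂⟩, h₃, h₄⟩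
    exact ⟨le_antisymm h₄ h₂, h₁, h₃⟩

lemma vSeg_eq_Icc (x y₁ y₂ : ℝ) : vSeg x y₁ y₂ = Set.Icc (x, y₁) (x, y₂) := by
  ext ⟨p, q⟩
  simp only [vSeg, Set.mem_ofPred_eq, Set.mem_Icc, Prod.mk_le_mk]
  constructor
  · rintro ⟨rfl, h₁, h₂⟩
    exact ⟨⟨le_rfl, h₁⟩, le_rfl, h₂⟩
  · rintro ⟨⟨h₁, h₂⟩, h₃, h₄⟩
    exact ⟨le_antisymm h₃ h₁, h₂, h₄⟩

lemma finite_hSeg_inter_vSeg (y x₁ x₂ x y₁ y₂ : ℝ) : (hSeg y x₁ x₂ ∩ vSeg x y₁ y₂).Finite := by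
  refine (Set.finite_singleton ((x, y) : ℝ × ℝ)).subset ?_
  rintro ⟨p, q⟩ ⟨⟨h₁, -⟩, h₂, -⟩
  exact Prod.ext h₂ h₁

lemma overlap_of_infinite_hSeg_inter {y x₁ x₂ y' x₁' x₂' : ℝ}
    (hi : (hSeg y x₁ x₂ ∩ hSeg y' x₁' x₂').Infinite) :
    y = y' ∧ max x₁ x₁' < min x₂ x₂' := by
  obtain ⟨⟨p, q⟩, ⟨⟨h₁, h₂, h₃⟩, h₄, h₅, h₆⟩, ⟨p', q'⟩, ⟨⟨h₁', h₂', h₃'⟩, h₄', h₅', h₆'⟩, hne⟩ :=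
    hi.nontrivial
  simp only at *
  have hp : p ≠ p' := fun hp => hne (Prod.ext hp (h₁.trans h₁'.symm))
  refine ⟨h₁.symm.trans h₄, max_lt (lt_min ?_ ?_) (lt_min ?_ ?_)⟩ <;>
    rcases lt_or_gt_of_ne hp with h | h <;> linarith

lemma overlap_of_infinite_vSeg_inter {x y₁ y₂ x' y₁' y₂' : ℝ}
    (hi : (vSeg x y₁ y₂ ∩ vSeg x' y₁' y₂').Infinite) :
    x = x' ∧ max y₁ y₁' < min y₂ y₂' := by
  obtain ⟨⟨p, q⟩, ⟨⟨h₁, h₂, h₃⟩, h₄, h₅, h₆⟩, ⟨p', q'⟩, ⟨⟨h₁', h₂', h₃'⟩, h₄', h₅', h₆'⟩, hne⟩ :=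
    hi.nontrivial
  simp only at *
  have hp : q ≠ q' := fun hp => hne (Prod.ext (h₁.trans h₁'.symm) hp)
  refine ⟨h₁.symm.trans h₄, max_lt (lt_min ?_ ?_) (lt_min ?_ ?_)⟩ <;>
    rcases lt_or_gt_of_ne hp with h | h <;> linarith

lemma sharesSeg_hSeg {y x₁ x₂ y' x₁' x₂' : ℝ} (h : y = y' ∧ max x₁ x₁' < min x₂ x₂') :
    SharesSeg (hSeg y x₁ x₂) (hSeg y' x₁' x₂') := by
  obtain ⟨rfl, hlt⟩ := h
  refine ⟨(max x₁ x₁', y), (min x₂ x₂', y), fun he => hlt.ne (congrArg Prod.fst he), ?_⟩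
  have hc : Convex ℝ (hSeg y x₁ x₂ ∩ hSeg y x₁' x₂') := by
    simp only [hSeg_eq_Icc]
    exact (convex_Icc _ _).inter (convex_Icc _ _)
  have := max_lt_iff.1 hlt
  have h₁ := lt_min_iff.1 this.1
  have h₂ := lt_min_iff.1 this.2
  refine hc.segment_subset ⟨⟨rfl, ?_, ?_⟩, rfl, ?_, ?_⟩ ⟨⟨rfl, ?_, ?_⟩, rfl, ?_, ?_⟩ <;>
    simp [h₁.1.le, h₁.2.le, h₂.1.le, h₂.2.le]

lemma sharesSeg_vSeg {x y₁ y₂ x' y₁' y₂' : ℝ} (h : x = x' ∧ max y₁ y₁' < min y₂ y₂') :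
    SharesSeg (vSeg x y₁ y₂) (vSeg x' y₁' y₂') := by
  obtain ⟨rfl, hlt⟩ := h
  refine ⟨(x, max y₁ y₁'), (x, min y₂ y₂'), fun he => hlt.ne (congrArg Prod.snd he), ?_⟩
  have hc : Convex ℝ (vSeg x y₁ y₂ ∩ vSeg x y₁' y₂') := by
    simp only [vSeg_eq_Icc]
    exact (convex_Icc _ _).inter (convex_Icc _ _)
  have := max_lt_iff.1 hlt
  have h₁ := lt_min_iff.1 this.1
  have h₂ := lt_min_iff.1 this.2
  refine hc.segment_subset ⟨⟨rfl, ?_, ?_⟩, rfl, ?_, ?_⟩ ⟨⟨rfl, ?_, ?_⟩, rfl, ?_, ?_⟩ <;>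
    simp [h₁.1.le, h₁.2.le, h₂.1.le, h₂.2.le]

lemma CShape_eq (x₁ x₂ x₃ y₁ y₂ : ℝ) :
    CShape x₁ x₂ x₃ y₁ y₂ = vSeg x₁ y₁ y₂ ∪ hSeg y₁ x₁ x₂ ∪ hSeg y₂ x₁ x₃ := rfl

lemma sharesSeg_CShape_iff (x₁ x₂ x₃ y₁ y₂ x₁' x₂' x₃' y₁' y₂' : ℝ) :
    SharesSeg (CShape x₁ x₂ x₃ y₁ y₂) (CShape x₁' x₂' x₃' y₁' y₂') ↔
      (x₁ = x₁' ∧ max y₁ y₁' < min y₂ y₂') ∨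
      (y₁ = y₁' ∧ max x₁ x₁' < min x₂ x₂') ∨ (y₁ = y₂' ∧ max x₁ x₁' < min x₂ x₃') ∨
      (y₂ = y₁' ∧ max x₁ x₁' < min x₃ x₂') ∨ (y₂ = y₂' ∧ max x₁ x₁' < min x₃ x₃') := by
  constructor
  · rintro ⟨p, q, hpq, hsub⟩
    by_contra hn
    simp only [not_or] at hn
    obtain ⟨h₁, h₂, h₃, h₄, h₅⟩ := hn
    refine (segment_infinite hpq).mono hsub ?_
    simp only [CShape_eq, Set.inter_union_distrib_left, Set.union_inter_distrib_right,
      Set.finite_union]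
    have hv := Set.not_infinite.1 (mt overlap_of_infinite_vSeg_inter h₁)
    have hh₂ := Set.not_infinite.1 (mt overlap_of_infinite_hSeg_inter h₂)
    have hh₃ := Set.not_infinite.1 (mt overlap_of_infinite_hSeg_inter h₃)
    have hh₄ := Set.not_infinite.1 (mt overlap_of_infinite_hSeg_inter h₄)
    have hh₅ := Set.not_infinite.1 (mt overlap_of_infinite_hSeg_inter h₅)
    have hhv := finite_hSeg_inter_vSeg
    have hvh : ∀ x y₁ y₂ y x₁ x₂, (vSeg x y₁ y₂ ∩ hSeg y x₁ x₂).Finite := fun _ _ _ _ _ _ =>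
      Set.inter_comm _ _ ▸ finite_hSeg_inter_vSeg _ _ _ _ _ _
    simp only [hv, hh₂, hh₃, hh₄, hh₅, hhv, hvh, and_self]
  · have hV : ∀ x₁ x₂ x₃ y₁ y₂, vSeg x₁ y₁ y₂ ⊆ CShape x₁ x₂ x₃ y₁ y₂ :=
      fun _ _ _ _ _ _ hp => Or.inl (Or.inl hp)
    have hB : ∀ x₁ x₂ x₃ y₁ y₂, hSeg y₁ x₁ x₂ ⊆ CShape x₁ x₂ x₃ y₁ y₂ :=
      fun _ _ _ _ _ _ hp => Or.inl (Or.inr hp)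
    have hU : ∀ x₁ x₂ x₃ y₁ y₂, hSeg y₂ x₁ x₃ ⊆ CShape x₁ x₂ x₃ y₁ y₂ :=
      fun _ _ _ _ _ _ hp => Or.inr hp
    rintro (h | h | h | h | h)
    · exact (sharesSeg_vSeg h).mono (hV ..) (hV ..)
    · exact (sharesSeg_hSeg h).mono (hB ..) (hB ..)
    · exact (sharesSeg_hSeg h).mono (hB ..) (hU ..)
    · exact (sharesSeg_hSeg h).mono (hU ..) (hB ..)
    · exact (sharesSeg_hSeg h).mono (hU ..) (hU ..)

/-- The C-shape with abscissae `x₁ / 4`, `x₂ / 4`, `x₃ / 4` and ordinates `y₁`, `y₂`. -/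
def intCShape (x₁ x₂ x₃ y₁ y₂ : ℤ) : Set (ℝ × ℝ) := CShape (x₁ / 4) (x₂ / 4) (x₃ / 4) y₁ y₂

/-- Two C-shapes with abscissae in `ℤ/4` and ordinates in `ℤ` share a segment iff two of their
parallel sides overlap, a condition on integers. -/
lemma sharesSeg_intCShape_iff (x₁ x₂ x₃ y₁ y₂ x₁' x₂' x₃' y₁' y₂' : ℤ) :
    SharesSeg (intCShape x₁ x₂ x₃ y₁ y₂) (intCShape x₁' x₂' x₃' y₁' y₂') ↔
      (x₁ = x₁' ∧ max y₁ y₁' < min y₂ y₂') ∨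
      (y₁ = y₁' ∧ max x₁ x₁' < min x₂ x₂') ∨ (y₁ = y₂' ∧ max x₁ x₁' < min x₂ x₃') ∨
      (y₂ = y₁' ∧ max x₁ x₁' < min x₃ x₂') ∨ (y₂ = y₂' ∧ max x₁ x₁' < min x₃ x₃') := by
  have h4 : (4 : ℝ) ≠ 0 := by norm_num
  have h4' : (0 : ℝ) < 4 := by norm_num
  rw [intCShape, intCShape, sharesSeg_CShape_iff]
  simp only [max_lt_iff, lt_min_iff, div_left_inj' h4, div_lt_div_iff_of_pos_right h4',
    Int.cast_inj, Int.cast_lt]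


/-! ### The four kinds of C-shapes

The abscissae are multiples of `1/4` and the ordinates are integers, so that whether two of the
shapes share a segment is decided by linear arithmetic in the positions and depths of the vertices
they represent. -/

/-- The C-shape of the `i`-th of `k` leaves, at depth `d` in a tree of height `h`. -/
def leafShape (k h i d : ℕ) : Set (ℝ × ℝ) :=
  intCShape (4 * i) (4 * i + 5) (if i = 0 ∨ i = k - 1 then 4 * k - 3 else 4 * i + 3) 0
    (if i = 0 ∨ i = k - 1 then h + 1 else h - d + 1)

/-- The C-shape of a vertex at depth `d` whose leaves are those with index from `s` to `t`. -/
def innerShape (h s t d : ℕ) : Set (ℝ × ℝ) :=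
  intCShape (4 * s + 2) (4 * t + 3) (4 * s + 3) (h - d) (h - d + 1)

/-- The C-shape of the parent of the last leaf, when it is at depth `d ≠ 0`. -/
def lastShape (k h d : ℕ) : Set (ℝ × ℝ) :=
  intCShape (4 * (k - 1 : ℕ) + 2) (4 * (k - 1 : ℕ) + 3) (4 * (k - 1 : ℕ) + 3) 0 (h - d + 1)

/-- The C-shape of the root, whose upper side ends at abscissa `x / 4`. -/
def rootShape (k h : ℕ) (x : ℤ) : Set (ℝ × ℝ) :=
  intCShape 2 (4 * (k - 1 : ℕ) + 3) x h (h + 1)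

lemma sharesSeg_leafShape_leafShape_iff {k h d d' i j : ℕ} (hi : i < k) (hj : j < k) (hij : i ≠ j)
    (hd₁ : 1 ≤ d) (hd : d ≤ h) (hd₁' : 1 ≤ d') (hd' : d' ≤ h) :
    SharesSeg (leafShape k h i d) (leafShape k h j d') ↔
      (j = i + 1 ∨ i = k - 1 ∧ j = 0) ∨ (i = j + 1 ∨ j = k - 1 ∧ i = 0) := by
  rw [leafShape, leafShape, sharesSeg_intCShape_iff]
  simp only [max_lt_iff, lt_min_iff, true_and]
  split_ifs <;> omega

lemma sharesSeg_leafShape_innerShape_iff {k h d d' i s t : ℕ} (hi : i < k) (hd : d ≤ h)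
    (hd₁' : 1 ≤ d') (hd' : d' + 1 ≤ h) (hst : s ≤ t) (hdeep : s ≤ i → i ≤ t → d' < d)
    (hfirst : i = 0 → d = 1) (hlast : i = k - 1 → i ≤ t → d' + 1 < d) :
    SharesSeg (leafShape k h i d) (innerShape h s t d') ↔
      i ≤ t ∧ s ≤ i ∧ (d' = d + 1 ∨ d = d' + 1) := by
  rw [leafShape, innerShape, sharesSeg_intCShape_iff]
  simp only [max_lt_iff, lt_min_iff]
  split_ifs <;> omega

lemma sharesSeg_leafShape_lastShape_iff {k h d d' i : ℕ} (hi : i < k) (hd₁' : 1 ≤ d')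
    (hd' : d' + 1 ≤ h) (hlast : i = k - 1 → d = d' + 1) :
    SharesSeg (leafShape k h i d) (lastShape k h d') ↔
      i ≤ k - 1 ∧ k - 1 ≤ i ∧ (d' = d + 1 ∨ d = d' + 1) := by
  rw [leafShape, lastShape, sharesSeg_intCShape_iff]
  simp only [max_lt_iff, lt_min_iff, true_and]
  split_ifs <;> omega

lemma sharesSeg_leafShape_rootShape_iff {k h d i : ℕ} {x : ℤ} (hk : 3 ≤ k) (hi : i < k)
    (hd₁ : 1 ≤ d) (hd : d ≤ h) (hfirst : i = 0 → d = 1)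
    (hx : x = 4 * k - 3 ∧ (i = k - 1 → d = 1) ∨ x = 4 ∧ (i = k - 1 → d ≠ 1)) :
    SharesSeg (leafShape k h i d) (rootShape k h x) ↔ d = 1 := by
  rw [leafShape, rootShape, sharesSeg_intCShape_iff]
  split_ifs <;> simp only [max_lt_iff, lt_min_iff, true_and] <;> omega

lemma sharesSeg_innerShape_innerShape_iff {h d d' s t s' t' : ℕ} (hst : s ≤ t) (hst' : s' ≤ t')
    (hsep : d = d' → t < s' ∨ t' < s) (hle : s ≤ t' → s' ≤ t → d ≤ d' → s ≤ s')
    (hle' : s ≤ t' → s' ≤ t → d' ≤ d → s' ≤ s) :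
    SharesSeg (innerShape h s t d) (innerShape h s' t' d') ↔
      s ≤ t' ∧ s' ≤ t ∧ (d' = d + 1 ∨ d = d' + 1) := by
  rw [innerShape, innerShape, sharesSeg_intCShape_iff]
  simp only [max_lt_iff, lt_min_iff]
  omega

lemma sharesSeg_lastShape_innerShape_iff {k h d d' s t : ℕ} (hd' : d' + 1 ≤ h) (hst : s ≤ t)
    (ht : t ≤ k - 1) (hlt : t = k - 1 → d' < d) :
    SharesSeg (lastShape k h d) (innerShape h s t d') ↔
      k - 1 ≤ t ∧ s ≤ k - 1 ∧ (d' = d + 1 ∨ d = d' + 1) := by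
  rw [lastShape, innerShape, sharesSeg_intCShape_iff]
  simp only [max_lt_iff, lt_min_iff]
  omega

lemma sharesSeg_rootShape_innerShape_iff {k h d s t : ℕ} {x : ℤ} (hd₁ : 1 ≤ d) (hst : s ≤ t)
    (ht : t ≤ k - 1) :
    SharesSeg (rootShape k h x) (innerShape h s t d) ↔ d = 1 := by
  rw [rootShape, innerShape, sharesSeg_intCShape_iff]
  simp only [max_lt_iff, lt_min_iff]
  omega

lemma sharesSeg_rootShape_lastShape_iff {k h d : ℕ} {x : ℤ} (hd₁ : 1 ≤ d) (hd : d + 1 ≤ h) :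
    SharesSeg (rootShape k h x) (lastShape k h d) ↔ d = 1 := by
  rw [rootShape, lastShape, sharesSeg_intCShape_iff]
  simp only [max_lt_iff, lt_min_iff]
  omega

/-! ### Ancestors in a rooted tree -/

section RootedTree

variable {V : Type*} {T : SimpleGraph V} {r u v w : V}

lemma length_eq_dist_of_isPath (hT : T.IsTree) {p : T.Walk u v} (hp : p.IsPath) :
    p.length = T.dist u v := by
  obtain ⟨q, hq, hlen⟩ := hT.connected.exists_path_of_dist u v
  rw [← hlen, (hT.existsUnique_path u v).unique hp hq]

lemma isAncestor_iff_mem_support (hT : T.IsTree) {p : T.Walk r v} (hp : p.IsPath) :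
    IsAncestor T r u v ↔ u ∈ p.support :=
  ⟨fun h => h p hp, fun h _ hq => (hT.existsUnique_path r v).unique hp hq ▸ h⟩

lemma dist_getVert (hT : T.IsTree) {p : T.Walk r v} (hp : p.IsPath) {i : ℕ}
    (hi : i ≤ T.dist r v) : T.dist r (p.getVert i) = i := by
  rw [← length_eq_dist_of_isPath hT (hp.take i), Walk.take_length, length_eq_dist_of_isPath hT hp]
  exact min_eq_left hi

lemma isAncestor_iff_getVert (hT : T.IsTree) {p : T.Walk r v} (hp : p.IsPath) :
    IsAncestor T r u v ↔ T.dist r u ≤ T.dist r v ∧ p.getVert (T.dist r u) = u := by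
  rw [isAncestor_iff_mem_support hT hp, Walk.mem_support_iff_exists_getVert,
    length_eq_dist_of_isPath hT hp]
  constructor
  · rintro ⟨i, rfl, hi⟩
    rw [dist_getVert hT hp hi]
    exact ⟨hi, rfl⟩
  · rintro ⟨hle, he⟩
    exact ⟨_, he, hle⟩

lemma IsAncestor.dist_le (hT : T.IsTree) (h : IsAncestor T r u v) : T.dist r u ≤ T.dist r v := by
  obtain ⟨p, hp, -⟩ := hT.connected.exists_path_of_dist r v
  exact ((isAncestor_iff_getVert hT hp).1 h).1

lemma IsAncestor.eq_of_dist_eq (hT : T.IsTree) (h : IsAncestor T r u v)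
    (hd : T.dist r u = T.dist r v) : u = v := by
  obtain ⟨p, hp, hlen⟩ := hT.connected.exists_path_of_dist r v
  rw [← ((isAncestor_iff_getVert hT hp).1 h).2, hd, ← hlen, Walk.getVert_length]

lemma IsAncestor.adj_of_dist_eq (hT : T.IsTree) (h : IsAncestor T r u v)
    (hd : T.dist r v = T.dist r u + 1) : T.Adj u v := by
  obtain ⟨p, hp, hlen⟩ := hT.connected.exists_path_of_dist r v
  have hadj := p.adj_getVert_succ (i := T.dist r u) (by omega)
  rwa [((isAncestor_iff_getVert hT hp).1 h).2, ← hd, ← hlen, Walk.getVert_length] at hadj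

lemma IsAncestor.getVert_eq (hT : T.IsTree) (h : IsAncestor T r u v) {p : T.Walk r u}
    (hp : p.IsPath) {q : T.Walk r v} (hq : q.IsPath) {i : ℕ} (hi : i ≤ T.dist r u) :
    p.getVert i = q.getVert i := by
  obtain ⟨-, he⟩ := (isAncestor_iff_getVert hT hq).1 h
  have hp' : ((q.take (T.dist r u)).copy rfl he).IsPath := by
    simpa using hq.take (T.dist r u)
  rw [(hT.existsUnique_path r u).unique hp hp', Walk.getVert_copy, Walk.take_getVert,
    min_eq_right hi]

lemma IsAncestor.trans (hT : T.IsTree) (h : IsAncestor T r u v) (h' : IsAncestor T r v w) :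
    IsAncestor T r u w := by
  obtain ⟨p, hp, -⟩ := hT.connected.exists_path_of_dist r v
  obtain ⟨q, hq, -⟩ := hT.connected.exists_path_of_dist r w
  have hu := (isAncestor_iff_getVert hT hp).1 h
  rw [isAncestor_iff_getVert hT hq, ← h'.getVert_eq hT hp hq hu.1]
  exact ⟨hu.1.trans (h'.dist_le hT), hu.2⟩

lemma IsAncestor.of_dist_le (hT : T.IsTree) (h : IsAncestor T r u w) (h' : IsAncestor T r v w)
    (hle : T.dist r u ≤ T.dist r v) : IsAncestor T r u v := by
  obtain ⟨p, hp, -⟩ := hT.connected.exists_path_of_dist r v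
  obtain ⟨q, hq, -⟩ := hT.connected.exists_path_of_dist r w
  rw [isAncestor_iff_getVert hT hp, h'.getVert_eq hT hp hq hle]
  exact ⟨hle, ((isAncestor_iff_getVert hT hq).1 h).2⟩

lemma isAncestor_root : IsAncestor T r r v := fun p _ => p.start_mem_support

lemma isAncestor_refl : IsAncestor T r v v := fun p _ => p.end_mem_support

/-- A proper ancestor of `v` has a child that is an ancestor of `v`. -/
lemma IsAncestor.exists_child (hT : T.IsTree) (h : IsAncestor T r u v) (hne : u ≠ v) :
    ∃ z, T.Adj u z ∧ T.dist r z = T.dist r u + 1 ∧ IsAncestor T r z v := by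
  have hlt : T.dist r u < T.dist r v :=
    (h.dist_le hT).lt_of_ne fun hd => hne (h.eq_of_dist_eq hT hd)
  obtain ⟨p, hp, hlen⟩ := hT.connected.exists_path_of_dist r v
  have hadj := p.adj_getVert_succ (i := T.dist r u) (by omega)
  rw [((isAncestor_iff_getVert hT hp).1 h).2] at hadj
  exact ⟨_, hadj, dist_getVert hT hp hlt,
    (isAncestor_iff_mem_support hT hp).2 (p.getVert_mem_support _)⟩

/-- Every vertex other than the root has a parent. -/
lemma exists_parent (hT : T.IsTree) (hne : v ≠ r) :
    ∃ w, T.Adj w v ∧ T.dist r v = T.dist r w + 1 ∧ IsAncestor T r w v := by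
  obtain ⟨p, hp, hlen⟩ := hT.connected.exists_path_of_dist r v
  have hpos := hT.connected.pos_dist_of_ne hne.symm
  have hd := dist_getVert hT hp (i := T.dist r v - 1) (by omega)
  have hanc : IsAncestor T r (p.getVert (T.dist r v - 1)) v :=
    (isAncestor_iff_mem_support hT hp).2 (p.getVert_mem_support _)
  exact ⟨_, hanc.adj_of_dist_eq hT (by omega), by omega, hanc⟩

lemma adj_iff_isAncestor (hT : T.IsTree) (r : V) : T.Adj u v ↔
    (IsAncestor T r u v ∧ T.dist r v = T.dist r u + 1) ∨
      (IsAncestor T r v u ∧ T.dist r u = T.dist r v + 1) := by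
  refine ⟨fun hadj => ?_, ?_⟩
  · have hdiff := hadj.diff_dist_adj (u := r)
    obtain ⟨p, hp, hlen⟩ := hT.connected.exists_path_of_dist r u
    by_cases hv : v ∈ p.support
    · have hanc := (isAncestor_iff_mem_support hT hp).2 hv
      have hle := hanc.dist_le hT
      have hne := mt (hanc.eq_of_dist_eq hT) hadj.ne'
      exact Or.inr ⟨hanc, by omega⟩
    · have hq := hp.concat hv hadj
      refine Or.inl ⟨(isAncestor_iff_mem_support hT hq).2 ?_, ?_⟩
      · simp [Walk.support_concat]
      · rw [← length_eq_dist_of_isPath hT hq, Walk.length_concat, hlen]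
  · rintro (⟨h, hd⟩ | ⟨h, hd⟩)
    · exact h.adj_of_dist_eq hT hd
    · exact (h.adj_of_dist_eq hT hd).symm

variable [Fintype V] [DecidableRel T.Adj]

lemma eq_of_adj_of_degree_eq_one (hd : T.degree u = 1) (hv : T.Adj u v) (hw : T.Adj u w) :
    v = w := by
  rw [← T.card_neighborFinset_eq_degree, Finset.card_eq_one] at hd
  obtain ⟨x, hx⟩ := hd
  have h₁ : v ∈ T.neighborFinset u := by simpa using hv
  have h₂ : w ∈ T.neighborFinset u := by simpa using hw
  rw [hx, Finset.mem_singleton] at h₁ h₂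
  exact h₁.trans h₂.symm

lemma eq_or_eq_of_adj_of_degree_eq_two {x : V} (hd : T.degree u = 2) (hv : T.Adj u v)
    (hw : T.Adj u w) (hvw : v ≠ w) (hx : T.Adj u x) : x = v ∨ x = w := by
  classical
  rw [← T.card_neighborFinset_eq_degree] at hd
  have hsub : ({v, w} : Finset V) ⊆ T.neighborFinset u := by
    intro y
    simp only [Finset.mem_insert, Finset.mem_singleton, mem_neighborFinset]
    rintro (rfl | rfl) <;> assumption
  have he := Finset.eq_of_subset_of_card_le hsub (by rw [hd, Finset.card_pair hvw])
  have hx' : x ∈ T.neighborFinset u := by simpa using hx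
  simpa [← he] using hx'

/-- A leaf other than the root has no proper descendants. -/
lemma IsAncestor.eq_of_degree_eq_one (hT : T.IsTree) (h : IsAncestor T r u v) (hur : u ≠ r)
    (hd : T.degree u = 1) : u = v := by
  by_contra hne
  obtain ⟨z, hz, hdz, -⟩ := h.exists_child hT hne
  obtain ⟨w, hw, hdw, -⟩ := exists_parent hT hur
  have := eq_of_adj_of_degree_eq_one hd hz hw.symm
  subst this
  omega

/-- A vertex of degree at least two has a child. -/
lemma exists_child_of_two_le_degree (hT : T.IsTree) (r : V) (hd : 2 ≤ T.degree u) :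
    ∃ z, T.dist r z = T.dist r u + 1 := by
  rw [← T.card_neighborFinset_eq_degree] at hd
  obtain ⟨x, hx, y, hy, hxy⟩ := Finset.one_lt_card.1 hd
  rw [mem_neighborFinset] at hx hy
  rcases (adj_iff_isAncestor hT r).1 hx with ⟨-, h⟩ | ⟨h, hdx⟩
  · exact ⟨x, h⟩
  rcases (adj_iff_isAncestor hT r).1 hy with ⟨-, h'⟩ | ⟨h', hdy⟩
  · exact ⟨y, h'⟩
  exact absurd ((h.of_dist_le hT h' (by omega)).eq_of_dist_eq hT (by omega)) hxy

end RootedTree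

lemma sInf_natCast_add {k s t : ℕ} {P : Fin k → Prop} (c : ℝ) (hs : s ≤ t) (ht : t < k)
    (hP : ∀ i : Fin k, P i ↔ s ≤ (i : ℕ) ∧ (i : ℕ) ≤ t) :
    sInf {x : ℝ | ∃ i : Fin k, P i ∧ x = ((i : ℕ) : ℝ) + c} = s + c := by
  refine IsLeast.csInf_eq ⟨⟨⟨s, by omega⟩, (hP _).2 ⟨le_rfl, hs⟩, rfl⟩, ?_⟩
  rintro _ ⟨i, hi, rfl⟩
  have : (s : ℝ) ≤ (i : ℕ) := by exact_mod_cast ((hP i).1 hi).1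
  linarith

lemma sSup_natCast_add {k s t : ℕ} {P : Fin k → Prop} (c : ℝ) (hs : s ≤ t) (ht : t < k)
    (hP : ∀ i : Fin k, P i ↔ s ≤ (i : ℕ) ∧ (i : ℕ) ≤ t) :
    sSup {x : ℝ | ∃ i : Fin k, P i ∧ x = ((i : ℕ) : ℝ) + c} = t + c := by
  refine IsGreatest.csSup_eq ⟨⟨⟨t, ht⟩, (hP _).2 ⟨hs, le_rfl⟩, rfl⟩, ?_⟩
  rintro _ ⟨i, hi, rfl⟩
  have : ((i : ℕ) : ℝ) ≤ t := by exact_mod_cast ((hP i).1 hi).2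
  linarith

lemma eq_cidx_succ_iff {k : ℕ} (hk : 0 < k) (i j : Fin k) :
    j = cidx hk ((i : ℕ) + 1) ↔
      (j : ℕ) = (i : ℕ) + 1 ∨ ((i : ℕ) = k - 1 ∧ (j : ℕ) = 0) := by
  rw [Fin.ext_iff, show (cidx hk ((i : ℕ) + 1) : ℕ) = ((i : ℕ) + 1) % k from rfl]
  rcases Nat.lt_or_ge ((i : ℕ) + 1) k with h | h
  · rw [Nat.mod_eq_of_lt h]
    omega
  · rw [show (i : ℕ) + 1 = k by omega, Nat.mod_self]
    omega

/-- the C-shapes form a valid B₂-EPG representation of the graph obtained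
from `T` by adding the cycle through its leaves. -/
theorem stmt16
    {V : Type*} [Fintype V] (T : SimpleGraph V) [DecidableRel T.Adj]
    (hT : T.IsTree) {k : ℕ} (hk : 3 ≤ k) (a : Fin k → V)
    (hinj : Function.Injective a)
    (hleaf : ∀ v : V, T.degree v = 1 ↔ ∃ i : Fin k, v = a i)
    (r : V) (hr : 2 ≤ T.degree r)
    (hconsec : ∀ u : V, 2 ≤ T.degree u → ∃ s t : Fin k, s ≤ t ∧
        LeafSet T r u = {x | ∃ j : Fin k, s ≤ j ∧ j ≤ t ∧ x = a j})
    (hra0 : T.Adj r (a ⟨0, by omega⟩))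
    (a' : V) (ha' : IsParent T r a' (a ⟨k - 1, by omega⟩))
    (ha'deg : T.degree a' = 2 ∨ a' = r)
    (h : ℕ) (hmax : IsGreatest (Set.range fun u : V => T.dist r u) h)
    (lx px qx ly ry : V → ℝ)
    (hla : ∀ i : Fin k, 1 ≤ (i : ℕ) → (i : ℕ) ≤ k - 2 →
      lx (a i) = ((i : ℕ) : ℝ) ∧ px (a i) = ((i : ℕ) : ℝ) + 1 + (1/4 : ℝ) ∧
      qx (a i) = ((i : ℕ) : ℝ) + 3 * (1/4 : ℝ) ∧ ly (a i) = 0 ∧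
      ry (a i) = (h : ℝ) - (T.dist r (a i) : ℝ) + 1)
    (ha0 : lx (a ⟨0, by omega⟩) = 0 ∧ px (a ⟨0, by omega⟩) = 1 + (1/4 : ℝ) ∧
      qx (a ⟨0, by omega⟩) = (k : ℝ) - 1 + (1/4 : ℝ) ∧ ly (a ⟨0, by omega⟩) = 0 ∧
      ry (a ⟨0, by omega⟩) = (h : ℝ) + 1)
    (hak : lx (a ⟨k - 1, by omega⟩) = (k : ℝ) - 1 ∧
      px (a ⟨k - 1, by omega⟩) = (k : ℝ) + (1/4 : ℝ) ∧
      qx (a ⟨k - 1, by omega⟩) = (k : ℝ) - 1 + (1/4 : ℝ) ∧ ly (a ⟨k - 1, by omega⟩) = 0 ∧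
      ry (a ⟨k - 1, by omega⟩) = (h : ℝ) + 1)
    (hintv : ∀ v : V, 2 ≤ T.degree v → v ≠ r → v ≠ a' →
      lx v = sInf {x : ℝ | ∃ i : Fin k, a i ∈ LeafSet T r v ∧
          x = ((i : ℕ) : ℝ) + 2 * (1/4 : ℝ)} ∧
      px v = sSup {x : ℝ | ∃ i : Fin k, a i ∈ LeafSet T r v ∧
          x = ((i : ℕ) : ℝ) + 3 * (1/4 : ℝ)} ∧
      qx v = sInf {x : ℝ | ∃ i : Fin k, a i ∈ LeafSet T r v ∧
          x = ((i : ℕ) : ℝ) + 3 * (1/4 : ℝ)} ∧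
      ly v = (h : ℝ) - (T.dist r v : ℝ) ∧ ry v = (h : ℝ) - (T.dist r v : ℝ) + 1)
    (hane : a' ≠ r →
      (lx a' = (k : ℝ) - 1 + 2 * (1/4 : ℝ) ∧ px a' = (k : ℝ) - 1 + 3 * (1/4 : ℝ) ∧
        qx a' = (k : ℝ) - 1 + 3 * (1/4 : ℝ) ∧ ly a' = 0 ∧
        ry a' = (h : ℝ) - (T.dist r a' : ℝ) + 1) ∧
      (lx r = 2 * (1/4 : ℝ) ∧ px r = (k : ℝ) - 1 + 3 * (1/4 : ℝ) ∧ qx r = 1 ∧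
        ly r = (h : ℝ) ∧ ry r = (h : ℝ) + 1))
    (haeq : a' = r →
      lx r = 2 * (1/4 : ℝ) ∧ px r = (k : ℝ) - 1 + 3 * (1/4 : ℝ) ∧
      qx r = (k : ℝ) - 1 + (1/4 : ℝ) ∧ ly r = (h : ℝ) ∧ ry r = (h : ℝ) + 1)
    :
    ∀ u v : V, u ≠ v →
      (SharesSeg (CShape (lx u) (px u) (qx u) (ly u) (ry u))
          (CShape (lx v) (px v) (qx v) (ly v) (ry v)) ↔
        (T.Adj u v ∨ ∃ i : Fin k,
          (u = a i ∧ v = a (cidx (by omega) ((i : ℕ) + 1))) ∨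
          (v = a i ∧ u = a (cidx (by omega) ((i : ℕ) + 1))))) := by
  intro u v huv
  -- leaves below each vertex form an interval of indices
  have hne_r : ∀ i, a i ≠ r := by
    rintro i rfl
    have := (hleaf (a i)).2 ⟨i, rfl⟩
    omega
  have hdeg : ∀ i, T.degree (a i) = 1 := fun i => (hleaf _).2 ⟨i, rfl⟩
  have hV : ∀ v, (∃ i, v = a i) ∨ 2 ≤ T.degree v := by
    intro v
    rcases Nat.lt_or_ge (T.degree v) 2 with hlt | hge
    · have : Nontrivial V := ⟨a ⟨0, by omega⟩, r, hne_r _⟩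
      have := hT.connected.preconnected.degree_pos_of_nontrivial v
      exact Or.inl ((hleaf v).1 (by omega))
    · exact Or.inr hge
  have hleaf_anc : ∀ i v, IsAncestor T r (a i) v → a i = v := fun i v hanc =>
    hanc.eq_of_degree_eq_one hT (hne_r i) (hdeg i)
  have hmemL : ∀ v j, a j ∈ LeafSet T r v ↔ IsAncestor T r v (a j) := fun v j =>
    ⟨fun hm => hm.2, fun hm => ⟨hdeg j, hm⟩⟩
  have hinterval : ∀ v, ∃ s t : ℕ, s ≤ t ∧ t < k ∧
      ∀ j : Fin k, IsAncestor T r v (a j) ↔ s ≤ (j : ℕ) ∧ (j : ℕ) ≤ t := by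
    intro v
    rcases hV v with ⟨i, rfl⟩ | hv
    · refine ⟨i, i, le_rfl, i.2, fun j => ⟨fun hanc => ?_, fun hj => ?_⟩⟩
      · rw [hinj (hleaf_anc _ _ hanc)]
        exact ⟨le_rfl, le_rfl⟩
      · rw [show j = i from Fin.ext (by omega)]
        exact isAncestor_refl
    · obtain ⟨s, t, hst, he⟩ := hconsec v hv
      refine ⟨s, t, hst, t.2, fun j => ?_⟩
      rw [← hmemL, he]
      constructor
      · rintro ⟨j', h₁, h₂, h₃⟩
        rw [hinj h₃]
        exact ⟨h₁, h₂⟩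
      · exact fun hj => ⟨j, hj.1, hj.2, rfl⟩
  choose s t hst htk hanc using hinterval
  have hcomp : ∀ u v, s u ≤ t v → s v ≤ t u → T.dist r u ≤ T.dist r v →
      IsAncestor T r u v := by
    intro u v h₁ h₂ hd
    have hu := hst u
    have hv := hst v
    have hm : max (s u) (s v) < k := by have := htk u; have := htk v; omega
    exact ((hanc u ⟨_, hm⟩).2 (by simp only; omega)).of_dist_le hT
      ((hanc v ⟨_, hm⟩).2 (by simp only; omega)) hd
  have hsub : ∀ u v, IsAncestor T r u v → s u ≤ s v ∧ t v ≤ t u := by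
    intro u v huv
    have hv := hst v
    have h₁ := (hanc u ⟨s v, hv.trans_lt (htk v)⟩).1 (huv.trans hT ((hanc v _).2 ⟨le_rfl, hv⟩))
    have h₂ := (hanc u ⟨t v, htk v⟩).1 (huv.trans hT ((hanc v _).2 ⟨hv, le_rfl⟩))
    exact ⟨h₁.1, h₂.2⟩
  have hsep : ∀ u v, u ≠ v → T.dist r u = T.dist r v → t u < s v ∨ t v < s u := by
    intro u v hne hd
    by_contra! hn
    exact hne ((hcomp u v hn.2 hn.1 hd.le).eq_of_dist_eq hT hd)
  have hadj : ∀ u v, T.Adj u v ↔ s u ≤ t v ∧ s v ≤ t u ∧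
      (T.dist r v = T.dist r u + 1 ∨ T.dist r u = T.dist r v + 1) := by
    intro u v
    have hu := hst u
    have hv := hst v
    rw [adj_iff_isAncestor hT r]
    constructor
    · rintro (⟨h₁, h₂⟩ | ⟨h₁, h₂⟩)
      · have := hsub _ _ h₁
        omega
      · have := hsub _ _ h₁
        omega
    · rintro ⟨h₁, h₂, h₃ | h₃⟩
      · exact Or.inl ⟨hcomp u v h₁ h₂ (by omega), h₃⟩
      · exact Or.inr ⟨hcomp v u h₂ h₁ (by omega), h₃⟩
  have hsleaf : ∀ i, s (a i) = i ∧ t (a i) = i := by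
    intro i
    have h₀ := hst (a i)
    have h₁ := (hanc (a i) i).1 isAncestor_refl
    have h₂ := hleaf_anc i _ ((hanc (a i) ⟨s (a i), h₀.trans_lt (htk _)⟩).2 ⟨le_rfl, h₀⟩)
    have h₃ := hleaf_anc i _ ((hanc (a i) ⟨t (a i), htk _⟩).2 ⟨h₀, le_rfl⟩)
    exact ⟨(Fin.ext_iff.1 (hinj h₂)).symm, (Fin.ext_iff.1 (hinj h₃)).symm⟩
  have hroot : s r = 0 ∧ t r = k - 1 := by
    have h₁ := (hanc r ⟨0, by omega⟩).1 isAncestor_root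
    have h₂ := (hanc r ⟨k - 1, by omega⟩).1 isAncestor_root
    have := htk r
    simp only at h₁ h₂
    omega
  have hdr : T.dist r r = 0 := dist_self
  have hpos : ∀ v, v ≠ r → 1 ≤ T.dist r v := fun v hv => hT.connected.pos_dist_of_ne hv.symm
  have hle : ∀ v, T.dist r v ≤ h := fun v => hmax.2 ⟨v, rfl⟩
  have hlt : ∀ v, 2 ≤ T.degree v → T.dist r v + 1 ≤ h := by
    intro v hv
    obtain ⟨z, hz⟩ := exists_child_of_two_le_degree hT r hv
    exact hz ▸ hle z
  have hne_leaf : ∀ v i, 2 ≤ T.degree v → v ≠ a i := by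
    rintro v i hv rfl
    have := hdeg i
    omega
  -- a leaf is deeper than the internal vertices above it
  have hdeep : ∀ v (i : Fin k), 2 ≤ T.degree v → s v ≤ (i : ℕ) → (i : ℕ) ≤ t v →
      T.dist r v < T.dist r (a i) := by
    intro v i hv h₁ h₂
    have hva := (hanc v i).2 ⟨h₁, h₂⟩
    exact (hva.dist_le hT).lt_of_ne fun hd => hne_leaf v i hv (hva.eq_of_dist_eq hT hd)
  have hd0 : ∀ i : Fin k, (i : ℕ) = 0 → T.dist r (a i) = 1 := by
    rintro ⟨_, _⟩ rfl
    exact dist_eq_one_iff_adj.2 hra0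
  have hda' : ∀ i : Fin k, (i : ℕ) = k - 1 → T.dist r (a i) = T.dist r a' + 1 := by
    rintro ⟨_, _⟩ rfl
    rcases (adj_iff_isAncestor hT r).1 ha'.2.2 with ⟨-, hd⟩ | ⟨hn, -⟩
    · exact hd
    · exact absurd (hleaf_anc _ _ hn).symm ha'.2.1
  have ha'two : 2 ≤ T.degree a' := by
    rcases ha'deg with hd | rfl
    · exact hd.ge
    · exact hr
  have hsa' : t a' = k - 1 ∧ (a' ≠ r → s a' = k - 1) := by
    have h₁ := (hanc a' ⟨k - 1, by omega⟩).1 ha'.1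
    have h₂ := htk a'
    have h₃ := hst a'
    simp only at h₁
    refine ⟨by omega, fun hne => ?_⟩
    have hd := ha'deg.resolve_right hne
    obtain ⟨w, hw, hdw, -⟩ := exists_parent hT hne
    have hm := (hanc a' ⟨s a', by omega⟩).2 ⟨le_rfl, h₃⟩
    obtain ⟨z, hz, hdz, hza⟩ := hm.exists_child hT (hne_leaf _ _ ha'two)
    have hwa : w ≠ a ⟨k - 1, by omega⟩ := by
      intro he
      have := he ▸ hda' _ rfl
      omega
    rcases eq_or_eq_of_adj_of_degree_eq_two hd hw.symm ha'.2.2 hwa hz with rfl | rfl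
    · omega
    · exact (Fin.ext_iff.1 (hinj (hleaf_anc _ _ hza))).symm
  set C : V → Set (ℝ × ℝ) := fun v => CShape (lx v) (px v) (qx v) (ly v) (ry v) with hC
  change SharesSeg (C u) (C v) ↔ _
  have hk' : ((k - 1 : ℕ) : ℝ) = k - 1 := by rw [Nat.cast_sub (by omega), Nat.cast_one]
  have hLeaf : ∀ i, C (a i) = leafShape k h i (T.dist r (a i)) := by
    intro i
    by_cases hend : (i : ℕ) = 0 ∨ (i : ℕ) = k - 1
    · rw [leafShape, if_pos hend, if_pos hend, intCShape]
      obtain ⟨i, hi⟩ := i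
      rcases hend with rfl | rfl
      · obtain ⟨h₁, h₂, h₃, h₄, h₅⟩ := ha0
        simp only [hC, h₁, h₂, h₃, h₄, h₅]
        congr 1 <;> push_cast <;> ring
      · obtain ⟨h₁, h₂, h₃, h₄, h₅⟩ := hak
        simp only [hC, h₁, h₂, h₃, h₄, h₅]
        congr 1 <;> push_cast [hk'] <;> ring
    · rw [leafShape, if_neg hend, if_neg hend, intCShape]
      obtain ⟨h₁, h₂, h₃, h₄, h₅⟩ := hla i (by omega) (by omega)
      simp only [hC, h₁, h₂, h₃, h₄, h₅]
      congr 1 <;> push_cast <;> ring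
  have hRoot : ∃ x : ℤ, C r = rootShape k h x ∧ (x = 4 * k - 3 ∧ a' = r ∨ x = 4 ∧ a' ≠ r) := by
    by_cases har : a' = r
    · refine ⟨4 * k - 3, ?_, Or.inl ⟨rfl, har⟩⟩
      obtain ⟨h₁, h₂, h₃, h₄, h₅⟩ := haeq har
      simp only [hC, h₁, h₂, h₃, h₄, h₅, rootShape, intCShape]
      congr 1 <;> push_cast [hk'] <;> ring
    · refine ⟨4, ?_, Or.inr ⟨rfl, har⟩⟩
      obtain ⟨-, h₁, h₂, h₃, h₄, h₅⟩ := hane har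
      simp only [hC, h₁, h₂, h₃, h₄, h₅, rootShape, intCShape]
      congr 1 <;> push_cast [hk'] <;> ring
  have hLast : a' ≠ r → C a' = lastShape k h (T.dist r a') := by
    intro har
    obtain ⟨⟨h₁, h₂, h₃, h₄, h₅⟩, -⟩ := hane har
    simp only [hC, h₁, h₂, h₃, h₄, h₅, lastShape, intCShape]
    congr 1 <;> push_cast [hk'] <;> ring
  have hInner : ∀ v, 2 ≤ T.degree v → v ≠ r → v ≠ a' →
      C v = innerShape h (s v) (t v) (T.dist r v) := by
    intro v hv hvr hva
    obtain ⟨h₁, h₂, h₃, h₄, h₅⟩ := hintv v hv hvr hva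
    have hP := fun j => (hmemL v j).trans (hanc v j)
    rw [sInf_natCast_add _ (hst v) (htk v) hP] at h₁ h₃
    rw [sSup_natCast_add _ (hst v) (htk v) hP] at h₂
    simp only [hC, h₁, h₂, h₃, h₄, h₅, innerShape, intCShape]
    congr 1 <;> push_cast <;> ring
  -- an internal vertex above the last leaf is an ancestor of the parent of that leaf
  have hlast : ∀ v, 2 ≤ T.degree v → v ≠ a' → t v = k - 1 → T.dist r v < T.dist r a' := by
    intro v hv hva htv
    have h₀ := hst v
    have h₁ := hdeep v ⟨k - 1, by omega⟩ hv (by simp only; omega) htv.ge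
    have h₂ := hda' ⟨k - 1, by omega⟩ rfl
    have h₃ := hsep v a' hva
    have h₄ := hst a'
    have h₅ := hsa'.1
    omega
  have hLL : ∀ i j : Fin k, i ≠ j → (SharesSeg (C (a i)) (C (a j)) ↔
      (j = cidx (by omega) ((i : ℕ) + 1) ∨ i = cidx (by omega) ((j : ℕ) + 1))) := by
    intro i j hij
    rw [hLeaf, hLeaf, eq_cidx_succ_iff, eq_cidx_succ_iff]
    exact sharesSeg_leafShape_leafShape_iff i.2 j.2 (Fin.val_ne_of_ne hij) (hpos _ (hne_r i))
      (hle _) (hpos _ (hne_r j)) (hle _)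
  have hLI : ∀ (i : Fin k) (v : V), 2 ≤ T.degree v →
      (SharesSeg (C (a i)) (C v) ↔ T.Adj (a i) v) := by
    intro i v hv
    rw [hLeaf]
    by_cases hvr : v = r
    · subst hvr
      obtain ⟨x, hCx, hx⟩ := hRoot
      rw [hCx, T.adj_comm, ← dist_eq_one_iff_adj]
      refine sharesSeg_leafShape_rootShape_iff hk i.2 (hpos _ (hne_r i)) (hle _) (hd0 i) ?_
      refine hx.imp (fun h₁ => ⟨h₁.1, fun hi => ?_⟩) (fun h₁ => ⟨h₁.1, fun hi => ?_⟩)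
      · rw [hda' i hi, h₁.2, hdr]
      · have := hda' i hi
        have := hpos a' h₁.2
        omega
    · rw [hadj, (hsleaf i).1, (hsleaf i).2]
      by_cases hva : v = a'
      · subst hva
        rw [hLast hvr, hsa'.1, hsa'.2 hvr]
        exact sharesSeg_leafShape_lastShape_iff i.2 (hpos v hvr) (hlt v hv) (hda' i)
      · rw [hInner v hv hvr hva]
        refine sharesSeg_leafShape_innerShape_iff i.2 (hle _) (hpos v hvr) (hlt v hv) (hst v)
          (hdeep v i hv) (hd0 i) fun hi hit => ?_
        have := hlast v hv hva (by have := htk v; omega)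
        have := hda' i hi
        omega
  have hRI : ∀ v, 2 ≤ T.degree v → v ≠ r → (SharesSeg (C r) (C v) ↔ T.Adj r v) := by
    intro v hv hvr
    obtain ⟨x, hCx, -⟩ := hRoot
    rw [hCx, ← dist_eq_one_iff_adj]
    by_cases hva : v = a'
    · subst hva
      rw [hLast hvr]
      exact sharesSeg_rootShape_lastShape_iff (hpos v hvr) (hlt v hv)
    · rw [hInner v hv hvr hva]
      exact sharesSeg_rootShape_innerShape_iff (hpos v hvr) (hst v) (Nat.le_sub_one_of_lt (htk v))
  have hAI : ∀ v, 2 ≤ T.degree v → v ≠ r → v ≠ a' → a' ≠ r →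
      (SharesSeg (C a') (C v) ↔ T.Adj a' v) := by
    intro v hv hvr hva har
    rw [hadj, hLast har, hInner v hv hvr hva, hsa'.1, hsa'.2 har]
    exact sharesSeg_lastShape_innerShape_iff (hlt v hv) (hst v) (Nat.le_sub_one_of_lt (htk v))
      (hlast v hv hva)
  have hII : ∀ u v : V, u ≠ v → 2 ≤ T.degree u → 2 ≤ T.degree v →
      (SharesSeg (C u) (C v) ↔ T.Adj u v) := by
    intro u v huv hu hv
    by_cases hur : u = r
    · subst hur
      exact hRI v hv huv.symm
    by_cases hvr : v = r
    · subst hvr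
      rw [sharesSeg_comm, T.adj_comm]
      exact hRI u hu huv
    by_cases hua : u = a'
    · subst hua
      exact hAI v hv hvr huv.symm hur
    by_cases hva : v = a'
    · subst hva
      rw [sharesSeg_comm, T.adj_comm]
      exact hAI u hu hur huv hvr
    rw [hadj, hInner u hu hur hua, hInner v hv hvr hva]
    exact sharesSeg_innerShape_innerShape_iff (hst u) (hst v) (hsep u v huv)
      (fun h₁ h₂ hd => (hsub u v (hcomp u v h₁ h₂ hd)).1)
      (fun h₁ h₂ hd => (hsub v u (hcomp v u h₂ h₁ hd)).1)
  have hnLL : ∀ i j, ¬ T.Adj (a i) (a j) := by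
    intro i j hij
    have := (hadj _ _).1 hij
    rw [(hsleaf i).1, (hsleaf i).2, (hsleaf j).1, (hsleaf j).2] at this
    exact hij.ne (congrArg a (Fin.ext (by omega)))
  rcases hV u with ⟨i, rfl⟩ | hu <;> rcases hV v with ⟨j, rfl⟩ | hv
  · have hij : i ≠ j := fun he => huv (congrArg a he)
    rw [hLL i j hij, or_iff_right (hnLL i j)]
    constructor
    · rintro (he | he)
      · exact ⟨i, Or.inl ⟨rfl, congrArg a he⟩⟩
      · exact ⟨j, Or.inr ⟨rfl, congrArg a he⟩⟩
    · rintro ⟨l, ⟨h₁, h₂⟩ | ⟨h₁, h₂⟩⟩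
      · exact Or.inl (hinj h₁ ▸ hinj h₂)
      · exact Or.inr (hinj h₁ ▸ hinj h₂)
  · rw [hLI i v hv, or_iff_left]
    rintro ⟨l, ⟨-, h₂⟩ | ⟨h₂, -⟩⟩ <;> exact hne_leaf _ _ hv h₂
  · rw [sharesSeg_comm, hLI j u hu, T.adj_comm, or_iff_left]
    rintro ⟨l, ⟨h₂, -⟩ | ⟨-, h₂⟩⟩ <;> exact hne_leaf _ _ hu h₂
  · rw [hII u v huv hu hv, or_iff_left]
    rintro ⟨l, ⟨h₂, -⟩ | ⟨h₂, -⟩⟩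
    · exact hne_leaf _ _ hu h₂
    · exact hne_leaf _ _ hv h₂
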